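/- Let ν be a probability measure on ℝ^k with ∫_{ℝ^k}|x|² ν(dx) < +∞, and let ν^n be the empirical measure of an i.i.d. sample from ν. Then almost surely d(ν^n, ν) → 0 as n → +∞. -/

import Mathlib

open MeasureTheory ProbabilityTheory

/-- The 2-Wasserstein (Vaserstein) distance between probability measures on `ℝ^k`,
defined as the infimum over couplings `Q` (with integrable quadratic cost) of
`(∫ |x - y|² dQ)^{1/2}`. -/
noncomputable def wassersteinDist {k : ℕ}
    (μ ν : Measure (EuclideanSpace ℝ (Fin k))) : ℝ :=
  sInf { r : ℝ | ∃ Q : Measure (EuclideanSpace ℝ (Fin k) × EuclideanSpace ℝ (Fin k)),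
    IsProbabilityMeasure Q ∧ Q.map Prod.fst = μ ∧ Q.map Prod.snd = ν ∧
    Integrable (fun p => ‖p.1 - p.2‖ ^ 2) Q ∧
    r = Real.sqrt (∫ p, ‖p.1 - p.2‖ ^ 2 ∂Q) }

/-- The empirical measure `ν^n = (1/n) ∑_{j=1}^n δ_{ξ_j(ω)}`. -/
noncomputable def empiricalMeasure {k : ℕ} {Ω : Type*}
    (ξ : ℕ → Ω → EuclideanSpace ℝ (Fin k)) (n : ℕ) (ω : Ω) :
    Measure (EuclideanSpace ℝ (Fin k)) :=
  (n : ENNReal)⁻¹ • ∑ j ∈ Finset.range n, Measure.dirac (ξ j ω)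

open MeasureTheory ProbabilityTheory Filter Topology
open scoped ENNReal

/-- split a finite measure into two pieces with prescribed masses -/
lemma split_meas {E : Type*} [MeasurableSpace E] (α : Measure E) [IsFiniteMeasure α]
    (c : ℝ≥0∞) (hc : c ≤ α Set.univ) :
    ∃ α' α'' : Measure E, α' + α'' = α ∧ α' Set.univ = c ∧ α'' Set.univ = α Set.univ - c := by
  have ht : c / α Set.univ ≤ 1 := ENNReal.div_le_of_le_mul (by simpa using hc)
  have hm : (c / α Set.univ) * α Set.univ = c := by
    by_cases h0 : α Set.univ = 0
    · have : c = 0 := by simpa [h0] using hc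
      simp [h0, this]
    · exact ENNReal.div_mul_cancel h0 (measure_ne_top _ _)
  refine ⟨(c / α Set.univ) • α, (1 - c / α Set.univ) • α, ?_, ?_, ?_⟩
  · rw [← add_smul, add_tsub_cancel_of_le ht, one_smul]
  · simpa using hm
  · have : (1 - c / α Set.univ) * α Set.univ = α Set.univ - c := by
      rw [ENNReal.sub_mul (fun _ _ => measure_ne_top _ _), one_mul, hm]
    simpa using this

/-- normalized product coupling -/
lemma prod_coupling {E : Type*} [MeasurableSpace E] (α β : Measure E) [IsFiniteMeasure α]
    [IsFiniteMeasure β] (h : α Set.univ = β Set.univ) :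
    ∃ D : Measure (E × E), D.map Prod.fst = α ∧ D.map Prod.snd = β ∧ D ≪ α.prod β := by
  refine ⟨(α Set.univ)⁻¹ • α.prod β, ?_, ?_, Measure.smul_absolutelyContinuous⟩
  · rw [Measure.map_smul, Measure.map_fst_prod, smul_smul, ← h]
    by_cases h0 : α Set.univ = 0
    · have : α = 0 := by simpa using h0
      simp [this]
    · rw [ENNReal.inv_mul_cancel h0 (measure_ne_top _ _), one_smul]
  · rw [Measure.map_smul, Measure.map_snd_prod, smul_smul]
    by_cases h0 : α Set.univ = 0
    · have : β = 0 := by rw [h] at h0; simpa using h0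
      simp [this]
    · rw [ENNReal.inv_mul_cancel h0 (measure_ne_top _ _), one_smul]

lemma restrict_decomp {E : Type*} [MeasurableSpace E] (μ : Measure E) (A : ℕ → Set E)
    (hA : ∀ i, MeasurableSet (A i)) (hd : Pairwise (Function.onFun Disjoint A)) (N : ℕ) :
    μ.restrict (⋃ i ∈ Finset.range N, A i)ᶜ + ∑ i ∈ Finset.range N, μ.restrict (A i) = μ := by
  have hU : MeasurableSet (⋃ i ∈ Finset.range N, A i) :=
    Finset.measurableSet_biUnion _ fun i _ => hA i
  have : μ.restrict (⋃ i ∈ Finset.range N, A i) = ∑ i ∈ Finset.range N, μ.restrict (A i) := by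
    ext s hs
    rw [Measure.restrict_apply hs, Measure.finsetSum_apply, Set.inter_iUnion₂,
      measure_biUnion_finset]
    · exact Finset.sum_congr rfl fun i _ => (Measure.restrict_apply hs).symm
    · intro i _ j _ hij
      exact (hd hij).mono Set.inter_subset_right Set.inter_subset_right
    · exact fun i _ => hs.inter (hA i)
  rw [← this, add_comm]
  exact Measure.restrict_add_restrict_compl hU

lemma enorm_sub_sq_le {E : Type*} [SeminormedAddCommGroup E] (x y : E) :
    ‖x - y‖ₑ ^ 2 ≤ 2 * ‖x‖ₑ ^ 2 + 2 * ‖y‖ₑ ^ 2 := by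
  have h : ‖x - y‖₊ ^ 2 ≤ 2 * ‖x‖₊ ^ 2 + 2 * ‖y‖₊ ^ 2 := by
    rw [← NNReal.coe_le_coe]; push_cast
    have := norm_sub_le x y
    nlinarith [norm_nonneg (x - y), sq_nonneg (‖x‖ - ‖y‖)]
  simp only [enorm]
  exact_mod_cast h

lemma cost_le_moments {E : Type*} [SeminormedAddCommGroup E] [MeasurableSpace E] [BorelSpace E]
    (D : Measure (E × E)) (α β : Measure E)
    (h1 : D.map Prod.fst = α) (h2 : D.map Prod.snd = β) :
    ∫⁻ p, ‖p.1 - p.2‖ₑ ^ 2 ∂D ≤ 2 * ∫⁻ x, ‖x‖ₑ ^ 2 ∂α + 2 * ∫⁻ x, ‖x‖ₑ ^ 2 ∂β := by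
  have m : Measurable (fun x : E => ‖x‖ₑ ^ 2) := by fun_prop
  calc _ ≤ ∫⁻ p, (2 * ‖p.1‖ₑ ^ 2 + 2 * ‖p.2‖ₑ ^ 2) ∂D :=
        lintegral_mono fun p => enorm_sub_sq_le _ _
    _ = _ := by
        rw [lintegral_add_left (by fun_prop), lintegral_const_mul _ (by fun_prop),
          lintegral_const_mul _ (by fun_prop), ← h1, ← h2,
          lintegral_map m measurable_fst, lintegral_map m measurable_snd]

/-- main coupling construction -/
lemma exists_coupling {E : Type*} [SeminormedAddCommGroup E] [MeasurableSpace E] [BorelSpace E]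
    (μ ν : Measure E) [IsProbabilityMeasure μ] [IsProbabilityMeasure ν] (A : ℕ → Set E)
    (hA : ∀ i, MeasurableSet (A i)) (hd : Pairwise (Function.onFun Disjoint A)) (N : ℕ)
    (e : ℝ≥0∞) (R : ℕ → ℝ≥0∞)
    (he : ∀ i, ∀ x ∈ A i, ∀ y ∈ A i, ‖x - y‖ₑ ^ 2 ≤ e) (hR : ∀ i, ∀ x ∈ A i, ‖x‖ₑ ^ 2 ≤ R i) :
    ∃ Q : Measure (E × E), Q.map Prod.fst = μ ∧ Q.map Prod.snd = ν ∧
      ∫⁻ p, ‖p.1 - p.2‖ₑ ^ 2 ∂Q ≤ e +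
        (2 * (∫⁻ x in (⋃ i ∈ Finset.range N, A i)ᶜ, ‖x‖ₑ ^ 2 ∂μ
            + ∑ i ∈ Finset.range N, R i * (μ (A i) - ν (A i)))
        + 2 * (∫⁻ x in (⋃ i ∈ Finset.range N, A i)ᶜ, ‖x‖ₑ ^ 2 ∂ν
            + ∑ i ∈ Finset.range N, R i * (ν (A i) - μ (A i)))) := by
  have hs1 : ∀ i, ∃ α' α'' : Measure E, α' + α'' = μ.restrict (A i) ∧
      α' Set.univ = min (μ (A i)) (ν (A i)) ∧ α'' Set.univ = μ (A i) - ν (A i) := by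
    intro i
    obtain ⟨a, b, h1, h2, h3⟩ := split_meas (μ.restrict (A i)) (min (μ (A i)) (ν (A i))) (by simp)
    exact ⟨a, b, h1, h2, by simpa [tsub_min] using h3⟩
  have hs2 : ∀ i, ∃ α' α'' : Measure E, α' + α'' = ν.restrict (A i) ∧
      α' Set.univ = min (μ (A i)) (ν (A i)) ∧ α'' Set.univ = ν (A i) - μ (A i) := by
    intro i
    obtain ⟨a, b, h1, h2, h3⟩ := split_meas (ν.restrict (A i)) (min (ν (A i)) (μ (A i))) (by simp)
    exact ⟨a, b, h1, by rw [h2, min_comm], by simpa [tsub_min] using h3⟩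
  choose a a' ha hau hau' using hs1
  choose b b' hb hbu hbu' using hs2
  have fa : ∀ i, IsFiniteMeasure (a i) := fun i => ⟨by
    rw [hau]; exact (min_le_left _ _).trans_lt (measure_lt_top _ _)⟩
  have fb : ∀ i, IsFiniteMeasure (b i) := fun i => ⟨by
    rw [hbu]; exact (min_le_left _ _).trans_lt (measure_lt_top _ _)⟩
  have fa' : ∀ i, IsFiniteMeasure (a' i) := fun i => ⟨by
    rw [hau']; exact tsub_le_self.trans_lt (measure_lt_top _ _)⟩
  have fb' : ∀ i, IsFiniteMeasure (b' i) := fun i => ⟨by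
    rw [hbu']; exact tsub_le_self.trans_lt (measure_lt_top _ _)⟩
  have sa : ∀ i, ∀ᵐ x ∂(a i), x ∈ A i := fun i =>
    (Measure.absolutelyContinuous_of_le (ha i ▸ Measure.le_add_right le_rfl)).ae_le
      (ae_restrict_mem (μ := μ) (hA i))
  have sb : ∀ i, ∀ᵐ x ∂(b i), x ∈ A i := fun i =>
    (Measure.absolutelyContinuous_of_le (hb i ▸ Measure.le_add_right le_rfl)).ae_le
      (ae_restrict_mem (μ := ν) (hA i))
  have sa' : ∀ i, ∀ᵐ x ∂(a' i), x ∈ A i := fun i =>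
    (Measure.absolutelyContinuous_of_le (ha i ▸ Measure.le_add_left le_rfl)).ae_le
      (ae_restrict_mem (μ := μ) (hA i))
  have sb' : ∀ i, ∀ᵐ x ∂(b' i), x ∈ A i := fun i =>
    (Measure.absolutelyContinuous_of_le (hb i ▸ Measure.le_add_left le_rfl)).ae_le
      (ae_restrict_mem (μ := ν) (hA i))
  set U := (⋃ i ∈ Finset.range N, A i)ᶜ with hU
  set a'' := μ.restrict U + ∑ i ∈ Finset.range N, a' i with ha''
  set b'' := ν.restrict U + ∑ i ∈ Finset.range N, b' i with hb''
  have da : a'' + ∑ i ∈ Finset.range N, a i = μ := by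
    conv_rhs => rw [← restrict_decomp μ A hA hd N]
    rw [ha'', add_assoc, ← Finset.sum_add_distrib]
    congr 1
    exact Finset.sum_congr rfl fun i _ => by rw [add_comm, ha]
  have db : b'' + ∑ i ∈ Finset.range N, b i = ν := by
    conv_rhs => rw [← restrict_decomp ν A hA hd N]
    rw [hb'', add_assoc, ← Finset.sum_add_distrib]
    congr 1
    exact Finset.sum_congr rfl fun i _ => by rw [add_comm, hb]
  have hmin : ∑ i ∈ Finset.range N, min (μ (A i)) (ν (A i)) ≤ 1 := by
    have := congrArg (fun m : Measure E => m Set.univ) da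
    simp only [Measure.add_apply, Measure.finsetSum_apply, hau, measure_univ] at this
    rw [← this]; exact le_add_self
  have hmass : a'' Set.univ = b'' Set.univ := by
    have h1 := congrArg (fun m : Measure E => m Set.univ) da
    have h2 := congrArg (fun m : Measure E => m Set.univ) db
    simp only [Measure.add_apply (μ₁ := a''), Measure.add_apply (μ₁ := b''),
      Measure.finsetSum_apply, hau, hbu, measure_univ] at h1 h2
    exact (ENNReal.add_left_inj (hmin.trans_lt ENNReal.one_lt_top).ne).1 (h1.trans h2.symm)
  have fa'' : IsFiniteMeasure a'' := by rw [ha'']; infer_instance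
  have fb'' : IsFiniteMeasure b'' := by rw [hb'']; infer_instance
  obtain ⟨D, hD1, hD2, -⟩ := prod_coupling a'' b'' hmass
  have hC : ∀ i, ∃ D : Measure (E × E), D.map Prod.fst = a i ∧ D.map Prod.snd = b i ∧
      D ≪ (a i).prod (b i) := fun i => prod_coupling (a i) (b i) (by rw [hau, hbu])
  choose C hC1 hC2 hC3 using hC
  have costC : ∀ i, ∫⁻ p, ‖p.1 - p.2‖ₑ ^ 2 ∂(C i) ≤ e * min (μ (A i)) (ν (A i)) := by
    intro i
    have m1 : ∀ᵐ p ∂(C i), p.1 ∈ A i := by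
      have := sa i; rw [← hC1 i] at this
      exact ae_of_ae_map measurable_fst.aemeasurable this
    have m2 : ∀ᵐ p ∂(C i), p.2 ∈ A i := by
      have := sb i; rw [← hC2 i] at this
      exact ae_of_ae_map measurable_snd.aemeasurable this
    calc _ ≤ ∫⁻ p, e ∂(C i) := by
          apply lintegral_mono_ae
          filter_upwards [m1, m2] with p h1 h2 using he i _ h1 _ h2
      _ = _ := by
          rw [lintegral_const, ← hau, ← hC1 i, Measure.map_apply measurable_fst MeasurableSet.univ]
          simp
  have costD := cost_le_moments D a'' b'' hD1 hD2
  have ma : ∫⁻ x, ‖x‖ₑ ^ 2 ∂a'' ≤ ∫⁻ x in U, ‖x‖ₑ ^ 2 ∂μ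
            + ∑ i ∈ Finset.range N, R i * (μ (A i) - ν (A i)) := by
    rw [ha'', lintegral_add_measure, lintegral_finsetSum_measure]
    gcongr with i hi
    rw [← hau', ← lintegral_const]
    apply lintegral_mono_ae
    filter_upwards [sa' i] with x hx using hR i x hx
  have mb : ∫⁻ x, ‖x‖ₑ ^ 2 ∂b'' ≤ ∫⁻ x in U, ‖x‖ₑ ^ 2 ∂ν
            + ∑ i ∈ Finset.range N, R i * (ν (A i) - μ (A i)) := by
    rw [hb'', lintegral_add_measure, lintegral_finsetSum_measure]
    gcongr with i hi
    rw [← hbu', ← lintegral_const]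
    apply lintegral_mono_ae
    filter_upwards [sb' i] with x hx using hR i x hx
  refine ⟨D + ∑ i ∈ Finset.range N, C i, ?_, ?_, ?_⟩
  · rw [Measure.map_add _ _ measurable_fst, ← Measure.mapₗ_apply_of_measurable measurable_fst (∑ i ∈ Finset.range N, C i),
      map_sum, hD1]
    simp only [Measure.mapₗ_apply_of_measurable measurable_fst, hC1, da]
  · rw [Measure.map_add _ _ measurable_snd, ← Measure.mapₗ_apply_of_measurable measurable_snd (∑ i ∈ Finset.range N, C i),
      map_sum, hD2]
    simp only [Measure.mapₗ_apply_of_measurable measurable_snd, hC2, db]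
  · rw [lintegral_add_measure, lintegral_finsetSum_measure, add_comm]
    gcongr
    · calc _ ≤ ∑ i ∈ Finset.range N, e * min (μ (A i)) (ν (A i)) :=
            Finset.sum_le_sum fun i _ => costC i
        _ = e * ∑ i ∈ Finset.range N, min (μ (A i)) (ν (A i)) := (Finset.mul_sum _ _ _).symm
        _ ≤ e * 1 := by gcongr
        _ = e := mul_one _
    · exact costD.trans (by gcongr)

lemma wdist_le {k : ℕ} (μ ν : Measure (EuclideanSpace ℝ (Fin k))) [IsProbabilityMeasure μ]
    (Q : Measure (EuclideanSpace ℝ (Fin k) × EuclideanSpace ℝ (Fin k)))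
    (h1 : Q.map Prod.fst = μ) (h2 : Q.map Prod.snd = ν) (δ : ℝ) (hδ : 0 ≤ δ)
    (h : ∫⁻ p, ‖p.1 - p.2‖ₑ ^ 2 ∂Q ≤ ENNReal.ofReal (δ ^ 2)) : wassersteinDist μ ν ≤ δ := by
  have hQ : IsProbabilityMeasure Q := ⟨by
    have : (Q.map Prod.fst) Set.univ = 1 := by rw [h1]; exact measure_univ
    rwa [Measure.map_apply measurable_fst MeasurableSet.univ, Set.preimage_univ] at this⟩
  have key : ∀ p : EuclideanSpace ℝ (Fin k) × EuclideanSpace ℝ (Fin k),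
      ENNReal.ofReal (‖p.1 - p.2‖ ^ 2) = ‖p.1 - p.2‖ₑ ^ 2 := fun p => by
    rw [ENNReal.ofReal_pow (norm_nonneg _), ofReal_norm]
  have meas : AEStronglyMeasurable (fun p : EuclideanSpace ℝ (Fin k) × EuclideanSpace ℝ (Fin k) =>
      ‖p.1 - p.2‖ ^ 2) Q := by
    apply Measurable.aestronglyMeasurable; fun_prop
  have h' : ∫⁻ p, ENNReal.ofReal (‖p.1 - p.2‖ ^ 2) ∂Q ≤ ENNReal.ofReal (δ ^ 2) := by
    simpa only [key] using h
  have hcostInt : Integrable (fun p : EuclideanSpace ℝ (Fin k) × EuclideanSpace ℝ (Fin k) =>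
      ‖p.1 - p.2‖ ^ 2) Q := by
    refine ⟨meas, ?_⟩
    rw [hasFiniteIntegral_iff_ofReal (ae_of_all _ fun p => by positivity)]
    exact h'.trans_lt ENNReal.ofReal_lt_top
  unfold wassersteinDist
  refine le_trans (b := Real.sqrt (∫ p, ‖p.1 - p.2‖ ^ 2 ∂Q))
    (csInf_le ⟨0, ?_⟩ ⟨Q, hQ, h1, h2, hcostInt, rfl⟩) ?_
  · rintro r ⟨_, _, _, _, _, rfl⟩; exact Real.sqrt_nonneg _
  · rw [integral_eq_lintegral_of_nonneg_ae (ae_of_all _ fun p => by positivity) meas]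
    apply Real.sqrt_le_iff.2 ⟨hδ, ENNReal.toReal_le_of_le_ofReal (by positivity) h'⟩

lemma wdist_nonneg {k : ℕ} (μ ν : Measure (EuclideanSpace ℝ (Fin k))) :
    0 ≤ wassersteinDist μ ν := by
  apply Real.sInf_nonneg
  rintro r ⟨_, _, _, _, _, rfl⟩; exact Real.sqrt_nonneg _

lemma empirical_prob {k : ℕ} {Ω : Type*} (ξ : ℕ → Ω → EuclideanSpace ℝ (Fin k)) (n : ℕ)
    (hn : n ≠ 0) (ω : Ω) : IsProbabilityMeasure (empiricalMeasure ξ n ω) := ⟨by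
  simp [empiricalMeasure, Measure.finsetSum_apply]
  exact ENNReal.inv_mul_cancel (by simpa using hn) (by simp)⟩

lemma slln_lintegral {k : ℕ} {Ω : Type*} [MeasurableSpace Ω]
    (P : Measure Ω) [IsProbabilityMeasure P]
    (ν : Measure (EuclideanSpace ℝ (Fin k)))
    (ξ : ℕ → Ω → EuclideanSpace ℝ (Fin k))
    (hmeas : ∀ i, Measurable (ξ i)) (hindep : iIndepFun ξ P) (hlaw : ∀ i, P.map (ξ i) = ν)
    (g : EuclideanSpace ℝ (Fin k) → ℝ) (hg : Measurable g) (h0 : ∀ x, 0 ≤ g x)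
    (hi : Integrable g ν) :
    ∀ᵐ ω ∂P, Tendsto (fun n => ∫⁻ x, ENNReal.ofReal (g x) ∂(empiricalMeasure ξ n ω)) atTop
      (𝓝 (∫⁻ x, ENNReal.ofReal (g x) ∂ν)) := by
  have hi0 : Integrable (fun ω => g (ξ 0 ω)) P := by
    rw [← hlaw 0] at hi; exact hi.comp_measurable (hmeas 0)
  have := strong_law_ae_real (μ := P) (fun i ω => g (ξ i ω)) hi0
    (fun i j hij => (hindep.indepFun hij).comp hg hg)
    (fun i => (IdentDistrib.mk (hmeas i).aemeasurable (hmeas 0).aemeasurable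
      (by rw [hlaw, hlaw])).comp hg)
  filter_upwards [this] with ω hω
  have e1 : ∫⁻ x, ENNReal.ofReal (g x) ∂ν = ENNReal.ofReal (∫ ω, g (ξ 0 ω) ∂P) := by
    rw [← ofReal_integral_eq_lintegral_ofReal hi (ae_of_all _ h0), ← hlaw 0,
      integral_map (hmeas 0).aemeasurable hg.aestronglyMeasurable]
  rw [e1]
  refine (ENNReal.tendsto_ofReal hω).congr' ?_
  filter_upwards [eventually_ne_atTop 0] with n hn
  have hn' : (0:ℝ) < n := by exact_mod_cast Nat.pos_of_ne_zero hn
  rw [empiricalMeasure, lintegral_smul_measure, lintegral_finsetSum_measure,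
    ENNReal.ofReal_div_of_pos hn', ENNReal.ofReal_sum_of_nonneg (fun i _ => h0 _)]
  simp [lintegral_dirac, ENNReal.div_eq_inv_mul]

theorem wasserstein_empirical_tendsto_ae {k : ℕ} {Ω : Type*} [MeasurableSpace Ω]
    (P : Measure Ω) [IsProbabilityMeasure P]
    (ν : Measure (EuclideanSpace ℝ (Fin k))) [IsProbabilityMeasure ν]
    (hν2 : Integrable (fun x => ‖x‖ ^ 2) ν)
    (ξ : ℕ → Ω → EuclideanSpace ℝ (Fin k))
    (hmeas : ∀ i, Measurable (ξ i))
    (hindep : iIndepFun ξ P)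
    (hlaw : ∀ i, P.map (ξ i) = ν) :
    ∀ᵐ ω ∂P, Filter.Tendsto (fun n => wassersteinDist (empiricalMeasure ξ n ω) ν)
      Filter.atTop (nhds 0) := by
  let d := TopologicalSpace.denseSeq (EuclideanSpace ℝ (Fin k))
  let ε : ℕ → ℝ := fun m => 1 / ((m : ℝ) + 1)
  have hε : ∀ m, 0 < ε m := fun m => by positivity
  let A : ℕ → ℕ → Set (EuclideanSpace ℝ (Fin k)) :=
    fun m => disjointed (fun j => Metric.ball (d j) (ε m))
  have hA : ∀ m j, MeasurableSet (A m j) := fun m j =>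
    MeasurableSet.disjointed (fun j => Metric.isOpen_ball.measurableSet) j
  have hd : ∀ m, Pairwise (Function.onFun Disjoint (A m)) := fun m => disjoint_disjointed _
  have hsub : ∀ m j, A m j ⊆ Metric.ball (d j) (ε m) := fun m j => disjointed_subset _ j
  have hcov : ∀ m, ⋃ j, A m j = Set.univ := fun m => by
    rw [iUnion_disjointed, Set.eq_univ_iff_forall]
    intro x
    obtain ⟨j, hj⟩ := (TopologicalSpace.denseRange_denseSeq _).exists_dist_lt x (hε m)
    exact Set.mem_iUnion.2 ⟨j, hj⟩
  let U : ℕ → ℕ → Set (EuclideanSpace ℝ (Fin k)) :=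
    fun m N => (⋃ i ∈ Finset.range N, A m i)ᶜ
  have hU : ∀ m N, MeasurableSet (U m N) := fun m N =>
    (Finset.measurableSet_biUnion _ fun i _ => hA m i).compl
  have key : ∀ x : EuclideanSpace ℝ (Fin k), ENNReal.ofReal (‖x‖ ^ 2) = ‖x‖ₑ ^ 2 := fun p => by
    rw [ENNReal.ofReal_pow (norm_nonneg _), ofReal_norm]
  have c1 : ∀ᵐ ω ∂P, ∀ m j, Tendsto (fun n => empiricalMeasure ξ n ω (A m j)) atTop
      (𝓝 (ν (A m j))) := by
    rw [ae_all_iff]; intro m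
    rw [ae_all_iff]; intro j
    have := slln_lintegral P ν ξ hmeas hindep hlaw ((A m j).indicator fun _ => 1)
      (measurable_const.indicator (hA m j)) (fun x => Set.indicator_nonneg (by simp) x)
      ((integrable_const _).indicator (hA m j))
    have e : ∀ x, ENNReal.ofReal ((A m j).indicator (fun _ => (1:ℝ)) x)
        = (A m j).indicator (fun _ => (1:ℝ≥0∞)) x := fun x => by
      by_cases hx : x ∈ A m j <;> simp [hx]
    simpa only [e, lintegral_indicator (hA m j), lintegral_const, one_mul,
      Measure.restrict_apply MeasurableSet.univ, Set.univ_inter] using this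
  have c2 : ∀ᵐ ω ∂P, ∀ m N, Tendsto
      (fun n => ∫⁻ x in U m N, ‖x‖ₑ ^ 2 ∂(empiricalMeasure ξ n ω)) atTop
      (𝓝 (∫⁻ x in U m N, ‖x‖ₑ ^ 2 ∂ν)) := by
    rw [ae_all_iff]; intro m
    rw [ae_all_iff]; intro N
    have := slln_lintegral P ν ξ hmeas hindep hlaw ((U m N).indicator fun x => ‖x‖ ^ 2)
      ((by fun_prop : Measurable fun x : EuclideanSpace ℝ (Fin k) => ‖x‖ ^ 2).indicator (hU m N))
      (fun x => Set.indicator_nonneg (fun x _ => by positivity) x)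
      (hν2.indicator (hU m N))
    have e : ∀ x, ENNReal.ofReal ((U m N).indicator (fun x => ‖x‖ ^ 2) x)
        = (U m N).indicator (fun x => ‖x‖ₑ ^ 2) x := fun x => by
      by_cases hx : x ∈ U m N
      · simp only [Set.indicator_of_mem hx, key]
      · simp [Set.indicator_of_notMem hx]
    simpa only [e, lintegral_indicator (hU m N)] using this
  have hfin : ∫⁻ x, ‖x‖ₑ ^ 2 ∂ν ≠ ∞ := by
    have := hν2.lintegral_lt_top
    simp only [key] at this
    exact this.ne
  have tail : ∀ m, Tendsto (fun N => ∫⁻ x in U m N, ‖x‖ₑ ^ 2 ∂ν) atTop (𝓝 0) := by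
    intro m
    have hanti : Antitone (U m) := fun M N h => Set.compl_subset_compl.2
      (Set.biUnion_subset_biUnion_left (by
        intro i hi; simp at hi ⊢; omega))
    have hz : ⋂ N, U m N = ∅ := by
      rw [Set.eq_empty_iff_forall_notMem]
      intro x hx
      have : x ∈ ⋃ j, A m j := by rw [hcov]; trivial
      obtain ⟨j, hj⟩ := Set.mem_iUnion.1 this
      exact (Set.mem_iInter.1 hx (j+1)) (Set.mem_biUnion (by simp) hj)
    apply tendsto_setLIntegral_zero hfin
    have := tendsto_measure_iInter_atTop (μ := ν) (fun N => (hU m N).nullMeasurableSet) hanti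
      ⟨0, measure_ne_top _ _⟩
    simpa [hz] using this
  filter_upwards [c1, c2] with ω h1 h2
  rw [Metric.tendsto_atTop']
  intro δ hδ
  have hδ2 : 0 < δ / 2 := by positivity
  -- choose m, N
  obtain ⟨m, hm⟩ : ∃ m, ENNReal.ofReal ((2 * ε m) ^ 2) < ENNReal.ofReal ((δ / 2) ^ 2 / 2) := by
    have : Tendsto (fun m => (2 * ε m) ^ 2) atTop (𝓝 ((2 * 0) ^ 2)) :=
      ((tendsto_one_div_add_atTop_nhds_zero_nat (𝕜 := ℝ)).const_mul 2).pow 2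
    obtain ⟨m, hm⟩ := (this.eventually_lt_const
      (show (2 * (0:ℝ)) ^ 2 < (δ / 2) ^ 2 / 2 by simp; positivity)).exists
    exact ⟨m, (ENNReal.ofReal_lt_ofReal_iff (by positivity)).2 hm⟩
  obtain ⟨N, hN⟩ : ∃ N, ENNReal.ofReal ((2 * ε m) ^ 2) + (2 * (∫⁻ x in U m N, ‖x‖ₑ ^ 2 ∂ν)
      + 2 * (∫⁻ x in U m N, ‖x‖ₑ ^ 2 ∂ν)) < ENNReal.ofReal ((δ / 2) ^ 2) := by
    have t := ENNReal.Tendsto.const_mul (a := 2) (tail m) (Or.inr (by simp))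
    have := (tendsto_const_nhds (x := ENNReal.ofReal ((2 * ε m) ^ 2))).add (t.add t)
    simp only [mul_zero, add_zero] at this
    exact (this.eventually_lt_const (hm.trans_le
      (ENNReal.ofReal_le_ofReal (by nlinarith [sq_nonneg (δ / 2)])))).exists
  let R : ℕ → ℝ≥0∞ := fun i => ENNReal.ofReal ((‖d i‖ + ε m) ^ 2)
  have hB : Tendsto (fun n => ENNReal.ofReal ((2 * ε m) ^ 2) +
        (2 * (∫⁻ x in U m N, ‖x‖ₑ ^ 2 ∂(empiricalMeasure ξ n ω)
            + ∑ i ∈ Finset.range N, R i * (empiricalMeasure ξ n ω (A m i) - ν (A m i)))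
        + 2 * (∫⁻ x in U m N, ‖x‖ₑ ^ 2 ∂ν
            + ∑ i ∈ Finset.range N, R i * (ν (A m i) - empiricalMeasure ξ n ω (A m i))))) atTop
      (𝓝 (ENNReal.ofReal ((2 * ε m) ^ 2) + (2 * (∫⁻ x in U m N, ‖x‖ₑ ^ 2 ∂ν + 
         ∑ i ∈ Finset.range N, R i * (ν (A m i) - ν (A m i)))
      + 2 * (∫⁻ x in U m N, ‖x‖ₑ ^ 2 ∂ν + 
         ∑ i ∈ Finset.range N, R i * (ν (A m i) - ν (A m i)))))) := by
    refine tendsto_const_nhds.add (Tendsto.add ?_ ?_)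
    · refine ENNReal.Tendsto.const_mul ((h2 m N).add (tendsto_finsetSum _ fun i _ => ?_))
        (Or.inr (by simp))
      exact ENNReal.Tendsto.const_mul (ENNReal.Tendsto.sub (h1 m i) tendsto_const_nhds
        (Or.inl (measure_ne_top _ _))) (Or.inr ENNReal.ofReal_ne_top)
    · refine ENNReal.Tendsto.const_mul (tendsto_const_nhds.add
        (tendsto_finsetSum _ fun i _ => ?_)) (Or.inr (by simp))
      exact ENNReal.Tendsto.const_mul (ENNReal.Tendsto.sub tendsto_const_nhds (h1 m i)
        (Or.inl (measure_ne_top _ _))) (Or.inr ENNReal.ofReal_ne_top)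
  simp only [tsub_self, mul_zero, Finset.sum_const_zero, add_zero] at hB
  obtain ⟨n0, hn0⟩ := eventually_atTop.1 (hB.eventually_lt_const hN)
  refine ⟨n0, fun n hn => ?_⟩
  have hp := empirical_prob ξ n (by omega) ω
  obtain ⟨Q, q1, q2, q3⟩ := exists_coupling (empiricalMeasure ξ n ω) ν (A m) (hA m) (hd m) N
    (ENNReal.ofReal ((2 * ε m) ^ 2)) R
    (fun i x hx y hy => by
      have hx' := mem_ball_iff_norm.1 (hsub m i hx)
      have hy' := mem_ball_iff_norm.1 (hsub m i hy)
      rw [← key]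
      apply ENNReal.ofReal_le_ofReal
      have : ‖x - y‖ ≤ ‖x - d i‖ + ‖y - d i‖ := by
        have := norm_sub_le (x - d i) (y - d i)
        simpa using this
      gcongr; linarith)
    (fun i x hx => by
      have hx' := mem_ball_iff_norm.1 (hsub m i hx)
      rw [← key]
      apply ENNReal.ofReal_le_ofReal
      have : ‖x‖ ≤ ‖x - d i‖ + ‖d i‖ := by
        have := norm_add_le (x - d i) (d i)
        simpa using this
      gcongr; linarith)
  have := wdist_le _ ν Q q1 q2 (δ / 2) hδ2.le (q3.trans (hn0 n hn.le).le)
  rw [Real.dist_eq, sub_zero, abs_of_nonneg (wdist_nonneg _ _)]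
  linarith
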